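/- Let μ ∈ ℝ with μ ≠ 0, and let φ₀ be a polynomial in the variables x^b and a^b satisfying Tφ₀ = □φ₀ = Dφ₀ = 0. Then χ := Σ_{k≥0} (−1)^k μ^{−k−1} (D†)^k φ₀ is a finite sum (hence a polynomial), satisfies Tχ = □χ = Dχ = 0, and (D† + μ)χ = φ₀. In particular, every totally traceless polynomial lies in the image of D† + μ acting on totally traceless polynomials. -/

import Mathlib

/- STATEMENT 12: For μ ≠ 0 and a totally traceless polynomial φ₀, the Neumann series
χ = Σ_k (−1)^k μ^{−k−1} (D†)^k φ₀ is a finite sum, is totally traceless, and satisfies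
(D† + μ)χ = φ₀. -/

noncomputable section

open MvPolynomial

/-- Index type: x-variables (left) and a-variables (right). -/
abbrev Idx (d : ℕ) := Fin d ⊕ Fin d

/-- Polynomials in the variables x^b and a^b. -/
abbrev Pol (d : ℕ) := MvPolynomial (Idx d) ℝ

/-- Diagonal entries of the Minkowski metric η = diag(1,−1,…,−1). -/
def eta (d : ℕ) (b : Fin d) : ℝ := if (b : ℕ) = 0 then 1 else -1

variable (d : ℕ)

/-- □ = η^{bc} ∂_{x^b} ∂_{x^c}. -/
def Box (f : Pol d) : Pol d :=
  ∑ b, eta d b • pderiv (Sum.inl b) (pderiv (Sum.inl b) f)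

/-- D = η^{bc} ∂_{a^b} ∂_{x^c}. -/
def Dop (f : Pol d) : Pol d :=
  ∑ b, eta d b • pderiv (Sum.inr b) (pderiv (Sum.inl b) f)

/-- T = η^{bc} ∂_{a^b} ∂_{a^c}. -/
def Trc (f : Pol d) : Pol d :=
  ∑ b, eta d b • pderiv (Sum.inr b) (pderiv (Sum.inr b) f)

/-- D† = a^b ∂_{x^b}. -/
def Ddag (f : Pol d) : Pol d :=
  ∑ b, X (Sum.inr b) * pderiv (Sum.inl b) f

theorem pderiv_pderiv_comm {R σ : Type*} [CommRing R] (i j : σ) (f : MvPolynomial σ R) :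
    pderiv i (pderiv j f) = pderiv j (pderiv i f) := by
  classical
  have h : ⁅(pderiv i : Derivation R (MvPolynomial σ R) (MvPolynomial σ R)),
      (pderiv j : Derivation R (MvPolynomial σ R) (MvPolynomial σ R))⁆ = 0 :=
    derivation_ext fun k => by
      by_cases hi : k = i <;> by_cases hj : k = j <;>
        simp [Derivation.commutator_apply, pderiv_X, Pi.single_apply, hi, hj, apply_ite]
  have h' := DFunLike.congr_fun h f
  rwa [Derivation.commutator_apply, Derivation.zero_apply, sub_eq_zero] at h'

/-- `D†` as a derivation. -/
def DdagDerivation : Derivation ℝ (Pol d) (Pol d) :=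
  mkDerivation ℝ (Sum.elim (fun b => X (Sum.inr b)) 0)

theorem DdagDerivation_apply (f : Pol d) : DdagDerivation d f = Ddag d f := by
  have hsum (g : Pol d) : (∑ b, (X (Sum.inr b) : Pol d) •
      (pderiv (Sum.inl b) : Derivation ℝ (Pol d) (Pol d))) g = Ddag d g := by
    rw [← Derivation.coeFnAddMonoidHom_apply, map_sum]
    simp [Ddag, Finset.sum_apply]
  rw [← hsum]
  refine DFunLike.congr_fun (derivation_ext fun i => ?_) f
  rw [hsum]
  rcases i with i | i <;>
    simp [DdagDerivation, mkDerivation_X, Ddag, pderiv_X, Pi.single_apply]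

variable {d}

theorem Ddag_X_mul (i : Idx d) (f : Pol d) :
    Ddag d (X i * f) = X i * Ddag d f + Ddag d (X i) * f := by
  simp only [← DdagDerivation_apply, Derivation.leibniz, smul_eq_mul]
  ring

theorem Ddag_X_inl (b : Fin d) : Ddag d (X (Sum.inl b)) = X (Sum.inr b) := by
  simp [← DdagDerivation_apply, DdagDerivation, mkDerivation_X]

theorem Ddag_X_inr (b : Fin d) : Ddag d (X (Sum.inr b)) = 0 := by
  simp [← DdagDerivation_apply, DdagDerivation, mkDerivation_X]

theorem Ddag_add (f g : Pol d) : Ddag d (f + g) = Ddag d f + Ddag d g := by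
  simp only [← DdagDerivation_apply, map_add]

theorem Ddag_smul (c : ℝ) (f : Pol d) : Ddag d (c • f) = c • Ddag d f := by
  simp only [← DdagDerivation_apply, Derivation.map_smul]

theorem Ddag_sum {ι : Type*} (s : Finset ι) (f : ι → Pol d) :
    Ddag d (∑ i ∈ s, f i) = ∑ i ∈ s, Ddag d (f i) := by
  simp only [← DdagDerivation_apply, map_sum]

theorem Ddag_zero : Ddag d 0 = 0 := by
  simp only [← DdagDerivation_apply, map_zero]

theorem iterate_Ddag_add (k : ℕ) (f g : Pol d) :
    (Ddag d)^[k] (f + g) = (Ddag d)^[k] f + (Ddag d)^[k] g := by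
  induction k with
  | zero => rfl
  | succ k ih => simp only [Function.iterate_succ_apply', ih, Ddag_add]

theorem iterate_Ddag_X_inr_mul (k : ℕ) (b : Fin d) (f : Pol d) :
    (Ddag d)^[k] (X (Sum.inr b) * f) = X (Sum.inr b) * (Ddag d)^[k] f := by
  induction k with
  | zero => rfl
  | succ k ih =>
    simp only [Function.iterate_succ_apply', ih, Ddag_X_mul, Ddag_X_inr, zero_mul, add_zero]

theorem iterate_succ_Ddag_X_inl_mul (k : ℕ) (b : Fin d) (f : Pol d) :
    (Ddag d)^[k + 1] (X (Sum.inl b) * f) =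
      X (Sum.inl b) * (Ddag d)^[k + 1] f + (k + 1 : ℝ) • (X (Sum.inr b) * (Ddag d)^[k] f) := by
  induction k with
  | zero => simp [Ddag_X_mul, Ddag_X_inl]
  | succ k ih =>
    rw [Function.iterate_succ_apply', ih]
    simp only [Ddag_add, Ddag_smul, Ddag_X_mul, Ddag_X_inl, Ddag_X_inr,
      ← Function.iterate_succ_apply', zero_mul, add_zero]
    push_cast
    module

/-- `D†` is locally nilpotent. -/
theorem exists_iterate_Ddag_eq_zero (f : Pol d) :
    ∃ N : ℕ, ∀ k : ℕ, N ≤ k → (Ddag d)^[k] f = 0 := by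
  induction f using MvPolynomial.induction_on with
  | C r =>
    refine ⟨1, fun k hk => ?_⟩
    obtain ⟨k, rfl⟩ := Nat.exists_eq_add_of_le' hk
    rw [Function.iterate_succ_apply, ← DdagDerivation_apply, derivation_C]
    exact Function.iterate_fixed Ddag_zero k
  | add f g hf hg =>
    obtain ⟨M, hM⟩ := hf
    obtain ⟨N, hN⟩ := hg
    refine ⟨max M N, fun k hk => ?_⟩
    rw [iterate_Ddag_add, hM k (le_of_max_le_left hk), hN k (le_of_max_le_right hk), add_zero]
  | mul_X f i hf =>
    obtain ⟨N, hN⟩ := hf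
    refine ⟨N + 1, fun k hk => ?_⟩
    obtain ⟨k, rfl⟩ := Nat.exists_eq_add_of_le' (Nat.le_of_add_left_le hk)
    rw [mul_comm]
    rcases i with b | b
    · rw [iterate_succ_Ddag_X_inl_mul, hN _ (by omega), hN _ (by omega)]
      simp
    · rw [iterate_Ddag_X_inr_mul, hN _ (by omega), mul_zero]

theorem pderiv_inl_Ddag (b : Fin d) (f : Pol d) :
    pderiv (Sum.inl b) (Ddag d f) = Ddag d (pderiv (Sum.inl b) f) := by
  simp [Ddag, pderiv_X, pderiv_pderiv_comm (Sum.inl b)]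

theorem pderiv_inr_Ddag (b : Fin d) (f : Pol d) :
    pderiv (Sum.inr b) (Ddag d f) =
      Ddag d (pderiv (Sum.inr b) f) + pderiv (Sum.inl b) f := by
  simp [Ddag, pderiv_X, pderiv_pderiv_comm (Sum.inr b), Pi.single_apply,
    Finset.sum_add_distrib, add_comm]

theorem Box_Ddag (f : Pol d) : Box d (Ddag d f) = Ddag d (Box d f) := by
  simp only [Box, pderiv_inl_Ddag, Ddag_sum, Ddag_smul]

theorem Dop_Ddag (f : Pol d) : Dop d (Ddag d f) = Ddag d (Dop d f) + Box d f := by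
  simp only [Dop, Box, pderiv_inl_Ddag, pderiv_inr_Ddag, Ddag_sum, Ddag_smul, smul_add,
    Finset.sum_add_distrib]

theorem Trc_Ddag (f : Pol d) : Trc d (Ddag d f) = Ddag d (Trc d f) + (2 : ℝ) • Dop d f := by
  simp only [Trc, Dop, pderiv_inr_Ddag, map_add, Ddag_sum, Ddag_smul, smul_add,
    Finset.sum_add_distrib, pderiv_pderiv_comm (Sum.inl _) (Sum.inr _)]
  module

theorem Box_sum_smul (s : Finset ℕ) (c : ℕ → ℝ) (f : ℕ → Pol d) :
    Box d (∑ k ∈ s, c k • f k) = ∑ k ∈ s, c k • Box d (f k) := by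
  simp only [Box, map_sum, Derivation.map_smul, Finset.smul_sum]
  rw [Finset.sum_comm]
  simp only [smul_comm (eta d _)]

theorem Dop_sum_smul (s : Finset ℕ) (c : ℕ → ℝ) (f : ℕ → Pol d) :
    Dop d (∑ k ∈ s, c k • f k) = ∑ k ∈ s, c k • Dop d (f k) := by
  simp only [Dop, map_sum, Derivation.map_smul, Finset.smul_sum]
  rw [Finset.sum_comm]
  simp only [smul_comm (eta d _)]

theorem Trc_sum_smul (s : Finset ℕ) (c : ℕ → ℝ) (f : ℕ → Pol d) :
    Trc d (∑ k ∈ s, c k • f k) = ∑ k ∈ s, c k • Trc d (f k) := by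
  simp only [Trc, map_sum, Derivation.map_smul, Finset.smul_sum]
  rw [Finset.sum_comm]
  simp only [smul_comm (eta d _)]

/-- `D†` preserves total tracelessness. -/
theorem iterate_Ddag_traceless {f : Pol d} (hT : Trc d f = 0) (hB : Box d f = 0)
    (hD : Dop d f = 0) (k : ℕ) :
    Trc d ((Ddag d)^[k] f) = 0 ∧ Box d ((Ddag d)^[k] f) = 0 ∧ Dop d ((Ddag d)^[k] f) = 0 := by
  induction k with
  | zero => exact ⟨hT, hB, hD⟩
  | succ k ih =>
    obtain ⟨h₁, h₂, h₃⟩ := ih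
    simp only [Function.iterate_succ_apply', Trc_Ddag, Box_Ddag, Dop_Ddag, h₁, h₂, h₃, Ddag_zero,
      smul_zero, add_zero, and_self]

theorem Ddag_add_smul_neumann_sum {μ : ℝ} (hμ : μ ≠ 0) (f : Pol d) (N : ℕ) :
    Ddag d (∑ k ∈ Finset.range N, ((-1) ^ k * (μ⁻¹) ^ (k + 1)) • (Ddag d)^[k] f) +
      μ • ∑ k ∈ Finset.range N, ((-1) ^ k * (μ⁻¹) ^ (k + 1)) • (Ddag d)^[k] f =
      f - ((-1) ^ N * (μ⁻¹) ^ N) • (Ddag d)^[N] f := by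
  induction N with
  | zero => simp [Ddag_zero]
  | succ N ih =>
    have hc : μ * ((-1) ^ N * (μ⁻¹) ^ (N + 1)) = (-1) ^ N * (μ⁻¹) ^ N := by
      linear_combination ((-1) ^ N * (μ⁻¹) ^ N) * mul_inv_cancel₀ hμ
    rw [Finset.sum_range_succ, Ddag_add, smul_add, add_add_add_comm, ih, Ddag_smul,
      ← Function.iterate_succ_apply' (Ddag d), smul_smul, hc]
    module

variable (d)

theorem stmt_12 (d : ℕ) (hd : 1 ≤ d) (μ : ℝ) (hμ : μ ≠ 0) (φ₀ : Pol d)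
    (hT : Trc d φ₀ = 0) (hB : Box d φ₀ = 0) (hD : Dop d φ₀ = 0) :
    ∃ N : ℕ, (∀ k : ℕ, N ≤ k → (Ddag d)^[k] φ₀ = 0) ∧
      ∀ χ : Pol d,
        χ = ∑ k ∈ Finset.range N, ((-1) ^ k * (μ⁻¹) ^ (k + 1)) • (Ddag d)^[k] φ₀ →
        Trc d χ = 0 ∧ Box d χ = 0 ∧ Dop d χ = 0 ∧ Ddag d χ + μ • χ = φ₀ := by
  obtain ⟨N, hN⟩ := exists_iterate_Ddag_eq_zero φ₀
  have h := iterate_Ddag_traceless hT hB hD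
  refine ⟨N, hN, ?_⟩
  rintro χ rfl
  refine ⟨?_, ?_, ?_, ?_⟩
  · simp only [Trc_sum_smul, (h _).1, smul_zero, Finset.sum_const_zero]
  · simp only [Box_sum_smul, (h _).2.1, smul_zero, Finset.sum_const_zero]
  · simp only [Dop_sum_smul, (h _).2.2, smul_zero, Finset.sum_const_zero]
  · rw [Ddag_add_smul_neumann_sum hμ, hN N le_rfl, smul_zero, sub_zero]

end
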